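/- Fix a prime p, m, n ∈ ℕ and a commutative ring R. In the tensor product B_{m,n}(R) ⊗_R B_{m,n}(R), write x = (x_i), y = (y_j) for the generators of the first factor and z = (z_i), t = (t_j) for the generators of the second factor. Then there is an R-algebra automorphism of B_{m,n}(R) ⊗_R B_{m,n}(R) sending x ↦ x + z, y ↦ y, z ↦ z and t ↦ t − y, where x + z and t − y denote the sum and difference of truncated p-typical Witt vectors, computed componentwise by the universal integral Witt addition/subtraction polynomials (well defined since all entries of x and z pairwise commute and all entries of y and t pairwise commute). In other words, B_{m,n}(R)(x,y) ⊗_R B_{m,n}(R)(z,t) = B_{m,n}(R)(x+z, y) ⊗_R B_{m,n}(R)(z, t−y). -/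

import Mathlib

noncomputable section

/-- The product `∏ i, x i ^ e i` over the support of `e`, with factors multiplied in
increasing order of the index. -/
def ordProd {σ M : Type*} [LinearOrder σ] [Monoid M] (x : σ → M) (e : σ →₀ ℕ) : M :=
  ((e.support.sort (· ≤ ·)).map fun i => x i ^ e i).prod

/-- Evaluation of a multivariate polynomial in a (possibly noncommutative) algebra:
each monomial is evaluated as the ordered product of the powers of the substituted
values, the variables being multiplied in increasing order of their (linearly ordered)
index. -/
def pEval {σ R A : Type*} [LinearOrder σ] [CommSemiring R] [Semiring A] [Algebra R A]
    (x : σ → A) (q : MvPolynomial σ R) : A :=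
  q.support.sum fun e => MvPolynomial.coeff e q • ordProd x e

/-- Evaluation of an integral polynomial in the commuting variables `X_d` (`d : ℕ+`, left
summand) and `Y_e` (`e : ℕ+`, right summand), substituting `x d` for `X_d` and `y e` for
`Y_e`; in each monomial all `X`-factors (in increasing index order) are multiplied to the
left of all `Y`-factors (in increasing index order), as appropriate for a polynomial in
`ℤ[X][Y]`. -/
def cEval {A : Type*} [Ring A] (x y : ℕ+ → A) (q : MvPolynomial (ℕ+ ⊕ₗ ℕ+) ℤ) : A :=
  pEval (fun v => Sum.elim x y (ofLex v)) q

/-- The `k`-th ghost value `w_k(g) = ∑_{d ∣ k} d · (g d)^(k/d)`. -/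
def ghost {A : Type*} [Ring A] (g : ℕ+ → A) (k : ℕ+) : A :=
  ∑ d ∈ (k : ℕ).divisors.attach,
    ((d : ℕ) : A) * g ⟨(d : ℕ), Nat.pos_of_mem_divisors d.2⟩ ^ ((k : ℕ) / (d : ℕ))

/-- The generator `x_d` of the free algebra underlying `B(ℚ)`. -/
def bXf (d : ℕ+) : FreeAlgebra ℚ (ℕ+ ⊕ ℕ+) := FreeAlgebra.ι ℚ (Sum.inl d)

/-- The generator `y_e` of the free algebra underlying `B(ℚ)`. -/
def bYf (e : ℕ+) : FreeAlgebra ℚ (ℕ+ ⊕ ℕ+) := FreeAlgebra.ι ℚ (Sum.inr e)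

/-- The defining relations of `B(ℚ)`: `[w_k(x), w_l(x)] = 0`, `[w_k(y), w_l(y)] = 0` and
`[w_l(y), w_k(x)] = δ_{k,l}·k` for all `k, l ≥ 1`. -/
inductive BRel : FreeAlgebra ℚ (ℕ+ ⊕ ℕ+) → FreeAlgebra ℚ (ℕ+ ⊕ ℕ+) → Prop
  | xx (k l : ℕ+) : BRel (ghost bXf k * ghost bXf l) (ghost bXf l * ghost bXf k)
  | yy (k l : ℕ+) : BRel (ghost bYf k * ghost bYf l) (ghost bYf l * ghost bYf k)
  | yx (k l : ℕ+) : BRel (ghost bYf l * ghost bXf k)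
      (ghost bXf k * ghost bYf l + if k = l then ((k : ℕ) : FreeAlgebra ℚ (ℕ+ ⊕ ℕ+)) else 0)

/-- The universal algebra `B(ℚ)`. -/
abbrev BQ : Type := RingQuot BRel

/-- The generator `x_d` of `B(ℚ)`. -/
def bx (d : ℕ+) : BQ := RingQuot.mkAlgHom ℚ BRel (bXf d)

/-- The generator `y_e` of `B(ℚ)`. -/
def by' (e : ℕ+) : BQ := RingQuot.mkAlgHom ℚ BRel (bYf e)

/-- `c` is a family of polynomials `c_{m,n}` as in the paper: `c m n` is an integral
polynomial in the variables `X_d` (`d` a proper divisor of `m`) and `Y_e` (`e` a proper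
divisor of `n`) such that `[y_n, x_m] = c_{m,n}(x, y)` holds in `B(ℚ)`. -/
def IsCFamily (c : ℕ+ → ℕ+ → MvPolynomial (ℕ+ ⊕ₗ ℕ+) ℤ) : Prop :=
  ∀ m n : ℕ+,
    (∀ v ∈ (c m n).vars,
      (∃ d : ℕ+, (d : ℕ) ∣ (m : ℕ) ∧ d ≠ m ∧ ofLex v = Sum.inl d) ∨
      (∃ e : ℕ+, (e : ℕ) ∣ (n : ℕ) ∧ e ≠ n ∧ ofLex v = Sum.inr e)) ∧
    cEval bx by' (c m n) = by' n * bx m - bx m * by' n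


/-- `p ^ i` as a positive natural number. -/
def ppow (p i : ℕ) : ℕ+ := (p ^ i).toPNat'

/-- Substitution of the generators `x_0, …, x_{m-1}` for the variables `X_{p^0}, …, X_{p^{m-1}}`
(the variable `X_{p^r}` is sent to `x_r`). -/
def sxm (R : Type*) [CommRing R] (p m n : ℕ) : ℕ+ → FreeAlgebra R (Fin m ⊕ Fin n) :=
  fun d => if h : padicValNat p (d : ℕ) < m
    then FreeAlgebra.ι R (Sum.inl ⟨padicValNat p (d : ℕ), h⟩) else 0

/-- Substitution of the generators `y_0, …, y_{n-1}` for the variables `Y_{p^0}, …, Y_{p^{n-1}}`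
(the variable `Y_{p^s}` is sent to `y_s`). -/
def syn (R : Type*) [CommRing R] (p m n : ℕ) : ℕ+ → FreeAlgebra R (Fin m ⊕ Fin n) :=
  fun e => if h : padicValNat p (e : ℕ) < n
    then FreeAlgebra.ι R (Sum.inr ⟨padicValNat p (e : ℕ), h⟩) else 0

/-- The defining relations of the truncated `p`-typical algebra `B_{m,n}(R)`:
`[x_i, x_{i'}] = 0`, `[y_j, y_{j'}] = 0` and
`[y_j, x_i] = c_{p^i, p^j}(x_0, …, x_{i-1}, y_0, …, y_{j-1})`. -/
inductive BmnRel (R : Type*) [CommRing R] (p : ℕ)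
    (c : ℕ+ → ℕ+ → MvPolynomial (ℕ+ ⊕ₗ ℕ+) ℤ) (m n : ℕ) :
    FreeAlgebra R (Fin m ⊕ Fin n) → FreeAlgebra R (Fin m ⊕ Fin n) → Prop
  | xx (i i' : Fin m) : BmnRel R p c m n
      (FreeAlgebra.ι R (Sum.inl i) * FreeAlgebra.ι R (Sum.inl i'))
      (FreeAlgebra.ι R (Sum.inl i') * FreeAlgebra.ι R (Sum.inl i))
  | yy (j j' : Fin n) : BmnRel R p c m n
      (FreeAlgebra.ι R (Sum.inr j) * FreeAlgebra.ι R (Sum.inr j'))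
      (FreeAlgebra.ι R (Sum.inr j') * FreeAlgebra.ι R (Sum.inr j))
  | yx (i : Fin m) (j : Fin n) : BmnRel R p c m n
      (FreeAlgebra.ι R (Sum.inr j) * FreeAlgebra.ι R (Sum.inl i))
      (FreeAlgebra.ι R (Sum.inl i) * FreeAlgebra.ι R (Sum.inr j) +
        cEval (sxm R p m n) (syn R p m n) (c (ppow p (i : ℕ)) (ppow p (j : ℕ))))

/-- The truncated `p`-typical algebra `B_{m,n}(R)`. -/
abbrev Bmn (R : Type*) [CommRing R] (p : ℕ) (c : ℕ+ → ℕ+ → MvPolynomial (ℕ+ ⊕ₗ ℕ+) ℤ)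
    (m n : ℕ) : Type _ := RingQuot (BmnRel R p c m n)

/-- The generator `x_i` of `B_{m,n}(R)`. -/
def gx (R : Type*) [CommRing R] (p : ℕ) (c : ℕ+ → ℕ+ → MvPolynomial (ℕ+ ⊕ₗ ℕ+) ℤ)
    (m n : ℕ) (i : Fin m) : Bmn R p c m n :=
  RingQuot.mkAlgHom R (BmnRel R p c m n) (FreeAlgebra.ι R (Sum.inl i))

/-- The generator `y_j` of `B_{m,n}(R)`. -/
def gy (R : Type*) [CommRing R] (p : ℕ) (c : ℕ+ → ℕ+ → MvPolynomial (ℕ+ ⊕ₗ ℕ+) ℤ)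
    (m n : ℕ) (j : Fin n) : Bmn R p c m n :=
  RingQuot.mkAlgHom R (BmnRel R p c m n) (FreeAlgebra.ι R (Sum.inr j))

open scoped TensorProduct

/-- Substitution used to express the Witt-vector sum `x + z` inside
`B_{m,n}(R) ⊗_R B_{m,n}(R)`: the variable of index `(0, k)` (for `k < m`) is sent to
`x_k ⊗ 1` and the variable of index `(1, k)` (for `k < m`) to `1 ⊗ z_k`. -/
def addSubstXZ (R : Type*) [CommRing R] (p : ℕ) (c : ℕ+ → ℕ+ → MvPolynomial (ℕ+ ⊕ₗ ℕ+) ℤ)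
    (m n : ℕ) : Fin 2 ×ₗ ℕ → (Bmn R p c m n ⊗[R] Bmn R p c m n) :=
  fun v =>
    if (ofLex v).1 = 0 then
      (if h : (ofLex v).2 < m then gx R p c m n ⟨(ofLex v).2, h⟩ ⊗ₜ[R] 1 else 0)
    else
      (if h : (ofLex v).2 < m then (1 : Bmn R p c m n) ⊗ₜ[R] gx R p c m n ⟨(ofLex v).2, h⟩
       else 0)

/-- Substitution used to express the Witt-vector difference `t − y` inside
`B_{m,n}(R) ⊗_R B_{m,n}(R)`: the variable of index `(0, k)` (for `k < n`) is sent to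
`1 ⊗ t_k` and the variable of index `(1, k)` (for `k < n`) to `y_k ⊗ 1`. -/
def subSubstTY (R : Type*) [CommRing R] (p : ℕ) (c : ℕ+ → ℕ+ → MvPolynomial (ℕ+ ⊕ₗ ℕ+) ℤ)
    (m n : ℕ) : Fin 2 ×ₗ ℕ → (Bmn R p c m n ⊗[R] Bmn R p c m n) :=
  fun v =>
    if (ofLex v).1 = 0 then
      (if h : (ofLex v).2 < n then (1 : Bmn R p c m n) ⊗ₜ[R] gy R p c m n ⟨(ofLex v).2, h⟩
       else 0)
    else
      (if h : (ofLex v).2 < n then gy R p c m n ⟨(ofLex v).2, h⟩ ⊗ₜ[R] 1 else 0)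

section PolynomialEvaluation

variable {σ A A' : Type*} [LinearOrder σ] [Ring A] [Ring A']

theorem map_ordProd (f : A →+* A') (x : σ → A) (e : σ →₀ ℕ) :
    f (ordProd x e) = ordProd (f ∘ x) e := by
  simp [ordProd, map_list_prod, Function.comp_def]

theorem map_pEval (f : A →+* A') (x : σ → A) (q : MvPolynomial σ ℤ) :
    f (pEval x q) = pEval (f ∘ x) q := by
  simp [pEval, map_sum, map_ordProd]

theorem pEval_congr {x x' : σ → A} {q : MvPolynomial σ ℤ} (h : ∀ v ∈ q.vars, x v = x' v) :
    pEval x q = pEval x' q := by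
  refine Finset.sum_congr rfl fun e he => ?_
  unfold ordProd
  congr 2
  refine List.map_congr_left fun i hi => ?_
  rw [h i ((MvPolynomial.mem_vars_iff_mem_support i).2 ⟨e, he, by simpa using hi⟩)]

theorem pEval_eq_aeval {C : Type*} [CommRing C] (x : σ → C) (q : MvPolynomial σ ℤ) :
    pEval x q = MvPolynomial.aeval x q := by
  rw [MvPolynomial.aeval_def, MvPolynomial.eval₂_eq]
  refine Finset.sum_congr rfl fun e _ => ?_
  rw [Algebra.smul_def, ordProd, ← Finset.prod_map_toList]
  congr 1
  exact ((Finset.sort_perm_toList _ _).map _).prod_eq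

theorem exists_algHom_eq_pEval {x : σ → A} (hx : ∀ u v, Commute (x u) (x v)) :
    ∃ F : MvPolynomial σ ℤ →ₐ[ℤ] A, (∀ v, F (MvPolynomial.X v) = x v) ∧ ∀ q, F q = pEval x q := by
  let S : Subalgebra ℤ A := Algebra.adjoin ℤ (Set.range x)
  have : IsMulCommutative S := Algebra.isMulCommutative_adjoin ℤ (by
    rintro _ ⟨u, rfl⟩ _ ⟨v, rfl⟩
    exact hx u v)
  let : CommRing S := { (inferInstance : Ring S) with mul_comm := this.is_comm.comm }
  let x' : σ → S := fun v => ⟨x v, Algebra.subset_adjoin ⟨v, rfl⟩⟩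
  refine ⟨S.val.comp (MvPolynomial.aeval x'), fun v => by simp [x'], fun q => ?_⟩
  have := map_pEval (S.val : S →+* A) x' q
  rw [pEval_eq_aeval] at this
  exact this

end PolynomialEvaluation

section Ghost

theorem mk_eq_toPNat' {d : ℕ} (hd : 0 < d) : (⟨d, hd⟩ : ℕ+) = d.toPNat' :=
  PNat.eq (by rw [Nat.toPNat'_coe, if_pos hd, PNat.mk_coe])

theorem ghost_eq_sum {A : Type*} [Ring A] (g : ℕ+ → A) (k : ℕ+) :
    ghost g k = ∑ d ∈ (k : ℕ).divisors, (d : A) * g d.toPNat' ^ ((k : ℕ) / d) := by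
  rw [← Finset.sum_attach]
  refine Finset.sum_congr rfl fun d _ => ?_
  congr 3
  exact mk_eq_toPNat' (Nat.pos_of_mem_divisors d.2)

theorem ghost_eq_add {A : Type*} [Ring A] (g : ℕ+ → A) (k : ℕ+) :
    ghost g k = (k : ℕ) * g k +
      ∑ d ∈ (k : ℕ).properDivisors, (d : A) * g d.toPNat' ^ ((k : ℕ) / d) := by
  rw [ghost_eq_sum, ← Nat.insert_self_properDivisors k.ne_zero,
    Finset.sum_insert (by simp), Nat.div_self k.pos, pow_one]
  simp

theorem ghost_ppow {A : Type*} [Ring A] (p : ℕ) [hp : Fact p.Prime] (g : ℕ+ → A) (k : ℕ) :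
    ghost g (ppow p k) =
      ∑ i ∈ Finset.range (k + 1), ((p ^ i : ℕ) : A) * g (ppow p i) ^ p ^ (k - i) := by
  have h : ((ppow p k : ℕ+) : ℕ) = p ^ k := by simp [ppow, hp.out.pos]
  rw [ghost_eq_sum, h, Nat.sum_divisors_prime_pow hp.out]
  refine Finset.sum_congr rfl fun i hi => ?_
  rw [Nat.pow_div (by simpa [Nat.lt_succ_iff] using hi) hp.out.pos]
  rfl

theorem map_ghost {A A' : Type*} [Ring A] [Ring A'] (f : A →+* A') (g : ℕ+ → A) (k : ℕ+) :
    f (ghost g k) = ghost (f ∘ g) k := by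
  simp [ghost_eq_sum]

variable {A A' : Type*} [Ring A] [Algebra ℚ A] [Ring A'] [Algebra ℚ A']

/-- The family with prescribed ghost values in a `ℚ`-algebra. -/
def unghost (g : ℕ+ → A) (k : ℕ+) : A :=
  ((k : ℕ) : ℚ)⁻¹ • (g k - ∑ d ∈ (k : ℕ).properDivisors.attach,
    ((d : ℕ) : A) * unghost g ⟨(d : ℕ), Nat.pos_of_mem_properDivisors d.2⟩ ^ ((k : ℕ) / (d : ℕ)))
termination_by (k : ℕ)
decreasing_by exact (Nat.mem_properDivisors.1 d.2).2

theorem unghost_eq (g : ℕ+ → A) (k : ℕ+) :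
    unghost g k = ((k : ℕ) : ℚ)⁻¹ • (g k - ∑ d ∈ (k : ℕ).properDivisors,
      (d : A) * unghost g d.toPNat' ^ ((k : ℕ) / d)) := by
  rw [unghost, ← Finset.sum_attach (k : ℕ).properDivisors]
  congr 2
  refine Finset.sum_congr rfl fun d _ => ?_
  congr 3
  exact mk_eq_toPNat' (Nat.pos_of_mem_properDivisors d.2)

theorem toPNat'_lt_of_mem_properDivisors {k : ℕ+} {d : ℕ} (hd : d ∈ (k : ℕ).properDivisors) :
    d.toPNat' < k := by
  rw [← PNat.coe_lt_coe, Nat.toPNat'_coe, if_pos (Nat.pos_of_mem_properDivisors hd)]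
  exact (Nat.mem_properDivisors.1 hd).2

theorem natCast_mul_eq_smul (k : ℕ) (a : A) : (k : A) * a = (k : ℚ) • a := by
  rw [Nat.cast_smul_eq_nsmul, nsmul_eq_mul]

theorem ghost_unghost (g : ℕ+ → A) (k : ℕ+) : ghost (unghost g) k = g k := by
  rw [ghost_eq_add, natCast_mul_eq_smul, unghost_eq g k, smul_smul,
    mul_inv_cancel₀ (by simp), one_smul, sub_add_cancel]

theorem unghost_ghost (h : ℕ+ → A) (k : ℕ+) : unghost (ghost h) k = h k := by
  induction k using PNat.strongInductionOn with
  | _ k ih =>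
    have hs : ∑ d ∈ (k : ℕ).properDivisors, (d : A) * unghost (ghost h) d.toPNat' ^ ((k : ℕ) / d) =
        ∑ d ∈ (k : ℕ).properDivisors, (d : A) * h d.toPNat' ^ ((k : ℕ) / d) :=
      Finset.sum_congr rfl fun d hd => by rw [ih _ (toPNat'_lt_of_mem_properDivisors hd)]
    rw [unghost_eq, hs, ghost_eq_add, natCast_mul_eq_smul, add_sub_cancel_right, smul_smul,
      inv_mul_cancel₀ (by simp), one_smul]

theorem commute_unghost_right {a : A} {g : ℕ+ → A} (h : ∀ k, Commute a (g k)) (k : ℕ+) :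
    Commute a (unghost g k) := by
  induction k using PNat.strongInductionOn with
  | _ k ih =>
    rw [unghost_eq]
    refine (Commute.sub_right (h k) (Commute.sum_right _ _ _ fun d hd => ?_)).smul_right _
    exact (Nat.cast_commute d a).symm.mul_right
      ((ih _ (toPNat'_lt_of_mem_properDivisors hd)).pow_right _)

theorem commute_unghost {g h : ℕ+ → A} (H : ∀ k l, Commute (g k) (h l)) (k l : ℕ+) :
    Commute (unghost g k) (unghost h l) :=
  commute_unghost_right (fun l => (commute_unghost_right (fun k => (H k l).symm) k).symm) l

theorem map_unghost (f : A →+* A') (g : ℕ+ → A) (k : ℕ+) :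
    f (unghost g k) = unghost (f ∘ g) k := by
  change (f ∘ unghost g) k = _
  rw [← unghost_ghost (f ∘ unghost g) k]
  congr 1
  funext l
  rw [← map_ghost, ghost_unghost, Function.comp_apply]

/-- The `p`-typical ghost components determine a sequence in a `ℚ`-algebra. -/
theorem eq_of_pTypical_ghost_eq (p : ℕ) [hp : Fact p.Prime] {a b : ℕ → A}
    (h : ∀ k, ∑ i ∈ Finset.range (k + 1), ((p ^ i : ℕ) : A) * a i ^ p ^ (k - i) =
      ∑ i ∈ Finset.range (k + 1), ((p ^ i : ℕ) : A) * b i ^ p ^ (k - i)) (k : ℕ) : a k = b k := by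
  induction k using Nat.strong_induction_on with
  | _ k ih =>
    have hk := h k
    have hs : ∑ i ∈ Finset.range k, ((p ^ i : ℕ) : A) * a i ^ p ^ (k - i) =
        ∑ i ∈ Finset.range k, ((p ^ i : ℕ) : A) * b i ^ p ^ (k - i) :=
      Finset.sum_congr rfl fun i hi => by rw [ih i (Finset.mem_range.1 hi)]
    rw [Finset.sum_range_succ, Finset.sum_range_succ, hs, add_right_inj, Nat.sub_self, pow_zero,
      pow_one, pow_one, natCast_mul_eq_smul, natCast_mul_eq_smul] at hk
    have hne : ((p ^ k : ℕ) : ℚ) ≠ 0 := by exact_mod_cast (pow_pos hp.out.pos k).ne'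
    exact (IsUnit.mk0 _ hne).smul_left_cancel.1 hk

end Ghost

section WeylFamilies

variable {A A' : Type*} [Ring A] [Ring A']

/-- Families satisfying the relations imposed on the ghost values of the generators of `B(ℚ)`. -/
structure IsWeyl (X Y : ℕ+ → A) : Prop where
  xx : ∀ k l, Commute (X k) (X l)
  yy : ∀ k l, Commute (Y k) (Y l)
  yx : ∀ k l, Y l * X k = X k * Y l + if k = l then ((k : ℕ) : A) else 0

theorem cEval_unghost_eq_commutator [Algebra ℚ A] {X Y : ℕ+ → A} (h : IsWeyl X Y)
    {c : ℕ+ → ℕ+ → MvPolynomial (ℕ+ ⊕ₗ ℕ+) ℤ} (hc : IsCFamily c) (k l : ℕ+) :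
    cEval (unghost X) (unghost Y) (c k l) =
      unghost Y l * unghost X k - unghost X k * unghost Y l := by
  let f : FreeAlgebra ℚ (ℕ+ ⊕ ℕ+) →ₐ[ℚ] A := FreeAlgebra.lift ℚ (Sum.elim (unghost X) (unghost Y))
  have hX (d : ℕ+) : f (ghost bXf d) = X d := by
    rw [← ghost_unghost X d]
    refine (map_ghost (f : _ →+* A) bXf d).trans (congrArg (ghost · d) (funext fun e => ?_))
    simp [f, bXf]
  have hY (d : ℕ+) : f (ghost bYf d) = Y d := by
    rw [← ghost_unghost Y d]
    refine (map_ghost (f : _ →+* A) bYf d).trans (congrArg (ghost · d) (funext fun e => ?_))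
    simp [f, bYf]
  have hf : ∀ ⦃a b⦄, BRel a b → f a = f b := by
    rintro _ _ (⟨k, l⟩ | ⟨k, l⟩ | ⟨k, l⟩)
    · simpa only [map_mul, hX] using (h.xx k l).eq
    · simpa only [map_mul, hY] using (h.yy k l).eq
    · rw [map_mul, map_add, map_mul, hX, hY, h.yx k l]
      split_ifs <;> simp
  let F : BQ →ₐ[ℚ] A := RingQuot.liftAlgHom ℚ ⟨f, hf⟩
  have hx : ⇑F ∘ bx = unghost X := funext fun d =>
    (RingQuot.liftAlgHom_mkAlgHom_apply ℚ f hf _).trans (by simp [f, bXf])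
  have hy : ⇑F ∘ by' = unghost Y := funext fun d =>
    (RingQuot.liftAlgHom_mkAlgHom_apply ℚ f hf _).trans (by simp [f, bYf])
  have key := congrArg F (hc k l).2
  rw [map_sub, map_mul, map_mul] at key
  have h1 (d : ℕ+) : F (bx d) = unghost X d := congrFun hx d
  have h2 (d : ℕ+) : F (by' d) = unghost Y d := congrFun hy d
  rw [h1, h2] at key
  rw [← key]
  refine Eq.trans ?_ (map_pEval (F : BQ →+* A) _ _).symm
  refine congrArg (pEval · _) (funext fun v => ?_)
  rcases hv : ofLex v with d | d <;> simp [hv, h1, h2]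

end WeylFamilies

section Pairs

variable {A A' : Type*} [Ring A] [Ring A'] {m n : ℕ}

/-- Extension of a finite sequence by zero. -/
def finExtend (x : Fin m → A) (k : ℕ) : A := if h : k < m then x ⟨k, h⟩ else 0

theorem map_finExtend (f : A →+* A') (x : Fin m → A) (k : ℕ) :
    f (finExtend x k) = finExtend (f ∘ x) k := by
  unfold finExtend
  split_ifs <;> simp

/-- The relations of `B_{m,n}`. -/
structure IsBPair (p : ℕ) (c : ℕ+ → ℕ+ → MvPolynomial (ℕ+ ⊕ₗ ℕ+) ℤ) (x : Fin m → A)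
    (y : Fin n → A) : Prop where
  xx : ∀ i i', Commute (x i) (x i')
  yy : ∀ j j', Commute (y j) (y j')
  yx : ∀ i j, y j * x i = x i * y j +
    cEval (fun d => finExtend x (padicValNat p d)) (fun e => finExtend y (padicValNat p e))
      (c (ppow p i) (ppow p j))

/-- The relations between the generators of `B_{m,n} ⊗ B_{m,n}`. -/
structure IsBQuad (p : ℕ) (c : ℕ+ → ℕ+ → MvPolynomial (ℕ+ ⊕ₗ ℕ+) ℤ) (x : Fin m → A)
    (y : Fin n → A) (z : Fin m → A) (t : Fin n → A) : Prop where
  left : IsBPair p c x y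
  right : IsBPair p c z t
  xz : ∀ i i', Commute (x i) (z i')
  xt : ∀ i j, Commute (x i) (t j)
  yz : ∀ j i, Commute (y j) (z i)
  yt : ∀ j j', Commute (y j) (t j')

theorem map_cEval_finExtend (f : A →+* A') (p : ℕ) (x : Fin m → A) (y : Fin n → A)
    (q : MvPolynomial (ℕ+ ⊕ₗ ℕ+) ℤ) :
    f (cEval (fun d => finExtend x (padicValNat p d)) (fun e => finExtend y (padicValNat p e)) q) =
      cEval (fun d => finExtend (f ∘ x) (padicValNat p d))
        (fun e => finExtend (f ∘ y) (padicValNat p e)) q := by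
  refine (map_pEval f _ _).trans (congrArg (pEval · _) (funext fun v => ?_))
  rcases hv : ofLex v with d | d <;> simp [hv, map_finExtend]

section

variable {p : ℕ} {c : ℕ+ → ℕ+ → MvPolynomial (ℕ+ ⊕ₗ ℕ+) ℤ} {x z : Fin m → A} {y t : Fin n → A}

theorem IsBPair.map (h : IsBPair p c x y) (f : A →+* A') : IsBPair p c (f ∘ x) (f ∘ y) where
  xx i i' := (h.xx i i').map f
  yy i i' := (h.yy i i').map f
  yx i j := by
    simpa only [map_mul, map_add, map_cEval_finExtend, Function.comp_apply] using congrArg f (h.yx i j)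

theorem IsBPair.of_map {f : A →+* A'} (hf : Function.Injective f)
    (h : IsBPair p c (f ∘ x) (f ∘ y)) : IsBPair p c x y where
  xx i i' := (h.xx i i').of_map hf
  yy i i' := (h.yy i i').of_map hf
  yx i j := hf <| by
    simpa only [map_mul, map_add, map_cEval_finExtend, Function.comp_apply] using h.yx i j

theorem IsBQuad.map (h : IsBQuad p c x y z t) (f : A →+* A') :
    IsBQuad p c (f ∘ x) (f ∘ y) (f ∘ z) (f ∘ t) where
  left := h.left.map f
  right := h.right.map f
  xz i j := (h.xz i j).map f
  xt i j := (h.xt i j).map f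
  yz i j := (h.yz i j).map f
  yt i j := (h.yt i j).map f

theorem IsBQuad.of_map {f : A →+* A'} (hf : Function.Injective f)
    (h : IsBQuad p c (f ∘ x) (f ∘ y) (f ∘ z) (f ∘ t)) : IsBQuad p c x y z t where
  left := h.left.of_map hf
  right := h.right.of_map hf
  xz i j := (h.xz i j).of_map hf
  xt i j := (h.xt i j).of_map hf
  yz i j := (h.yz i j).of_map hf
  yt i j := (h.yt i j).of_map hf

theorem finExtend_padicValNat_ppow [hp : Fact p.Prime] (x : Fin m → A) (i : ℕ) :
    finExtend x (padicValNat p (ppow p i)) = finExtend x i := by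
  congr 1
  simp [ppow, hp.out.pos]

/-- Proper divisors of `p ^ i` are the smaller powers of `p`. -/
theorem exists_ppow_of_dvd [hp : Fact p.Prime] {i : ℕ} {d : ℕ+}
    (h : (d : ℕ) ∣ (ppow p i : ℕ)) (hne : d ≠ ppow p i) : ∃ r < i, d = ppow p r := by
  have hc (k : ℕ) : ((ppow p k : ℕ+) : ℕ) = p ^ k := by simp [ppow, hp.out.pos]
  rw [hc] at h
  obtain ⟨r, hr, hd⟩ := (Nat.dvd_prime_pow hp.out).1 h
  have hd' : d = ppow p r := PNat.eq (by rw [hd, hc])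
  refine ⟨r, lt_of_le_of_ne hr ?_, hd'⟩
  rintro rfl
  exact hne hd'

theorem IsWeyl.isBPair [Fact p.Prime] [Algebra ℚ A] {X Y : ℕ+ → A} (h : IsWeyl X Y)
    (hc : IsCFamily c) :
    IsBPair p c (fun i : Fin m => unghost X (ppow p i)) (fun j : Fin n => unghost Y (ppow p j)) where
  xx _ _ := commute_unghost h.xx _ _
  yy _ _ := commute_unghost h.yy _ _
  yx i j := by
    rw [← sub_eq_iff_eq_add', ← cEval_unghost_eq_commutator h hc]
    refine pEval_congr fun v hv => ?_
    obtain ⟨d, hd, hne, hv⟩ | ⟨d, hd, hne, hv⟩ := (hc _ _).1 v hv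
    · obtain ⟨r, hr, rfl⟩ := exists_ppow_of_dvd hd hne
      simp only [hv, Sum.elim_inl, finExtend_padicValNat_ppow]
      simp [finExtend, hr.trans i.2]
    · obtain ⟨r, hr, rfl⟩ := exists_ppow_of_dvd hd hne
      simp only [hv, Sum.elim_inr, finExtend_padicValNat_ppow]
      simp [finExtend, hr.trans j.2]

end

/-- The combination `x + ε z` of truncated `p`-typical Witt vectors. -/
def wittComb (p : ℕ) [Fact p.Prime] (ε : ℤ) (x z : Fin m → A) (i : Fin m) : A :=
  pEval (fun v : Fin 2 ×ₗ ℕ =>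
      if (ofLex v).1 = 0 then finExtend x (ofLex v).2 else finExtend z (ofLex v).2)
    (MvPolynomial.rename (toLex : Fin 2 × ℕ → Fin 2 ×ₗ ℕ)
      (wittStructureInt p (MvPolynomial.X 0 + MvPolynomial.C ε * MvPolynomial.X 1) i))

theorem map_wittComb (f : A →+* A') (p : ℕ) [Fact p.Prime] (ε : ℤ) (x z : Fin m → A) (i : Fin m) :
    f (wittComb p ε x z i) = wittComb p ε (f ∘ x) (f ∘ z) i := by
  refine (map_pEval f _ _).trans (congrArg (pEval · _) (funext fun v => ?_))
  simp only [Function.comp_apply]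
  split_ifs <;> exact map_finExtend ..

theorem wittComb_unghost [Algebra ℚ A] (p : ℕ) [Fact p.Prime] (ε : ℤ) {g h : ℕ+ → A}
    (hgg : ∀ k l, Commute (g k) (g l)) (hgh : ∀ k l, Commute (g k) (h l))
    (hhh : ∀ k l, Commute (h k) (h l)) (i : Fin m) :
    wittComb p ε (fun i : Fin m => unghost g (ppow p i)) (fun i => unghost h (ppow p i)) i =
      unghost (fun k => g k + ε * h k) (ppow p i) := by
  let s : Fin 2 ×ₗ ℕ → A := fun v =>
    if (ofLex v).1 = 0 then unghost g (ppow p (ofLex v).2) else unghost h (ppow p (ofLex v).2)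
  have hs u v : Commute (s u) (s v) := by
    simp only [s]
    split_ifs
    exacts [commute_unghost hgg _ _, commute_unghost hgh _ _,
      (commute_unghost hgh _ _).symm, commute_unghost hhh _ _]
  obtain ⟨F, hFX, hF⟩ := exists_algHom_eq_pEval hs
  let Φ : MvPolynomial (Fin 2) ℤ := MvPolynomial.X 0 + MvPolynomial.C ε * MvPolynomial.X 1
  let F' : MvPolynomial (Fin 2 × ℕ) ℤ →ₐ[ℤ] A := F.comp (MvPolynomial.rename toLex)
  have hF' (a : Fin 2) (k : ℕ) : F' (MvPolynomial.X (a, k)) = s (toLex (a, k)) := by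
    simp [F', hFX]
  have hC (a : ℤ) : F' (MvPolynomial.C a) = a := by
    simp
  have key : ∀ k, F' (wittStructureInt p Φ k) = unghost (fun k => g k + ε * h k) (ppow p k) := by
    refine eq_of_pTypical_ghost_eq p fun k => ?_
    rw [← ghost_ppow, ghost_unghost]
    have := congrArg F' (wittStructureInt_prop p Φ k)
    simp only [wittPolynomial_eq_sum_C_mul_X_pow, map_sum, map_mul, map_pow, MvPolynomial.bind₁_X_right,
      MvPolynomial.rename_X, MvPolynomial.bind₁_C_right, MvPolynomial.rename_C, hC, Φ, map_add,
      hF'] at this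
    rw [← ghost_unghost g, ← ghost_unghost h, ghost_ppow, ghost_ppow]
    simpa [s, Φ] using this
  rw [← key]
  change _ = F (MvPolynomial.rename toLex _)
  rw [hF]
  refine pEval_congr fun v hv => ?_
  obtain ⟨w, hw, rfl⟩ := Finset.mem_image.1 (MvPolynomial.vars_rename _ _ hv)
  have hlt := (Finset.mem_product.1 (wittStructureInt_vars p _ _ hw)).2
  have : w.2 < m := (Nat.lt_succ_iff.1 (Finset.mem_range.1 hlt)).trans_lt i.2
  by_cases h0 : w.1 = 0 <;> simp [s, finExtend, this, h0]

end Pairs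

section Spanning

variable {A : Type*} [Ring A]

open Subalgebra (toSubmodule)

theorem mul_mem_toSubmodule_mul {X Y : Subalgebra ℤ A} {a b : A} (ha : a ∈ X) (hb : b ∈ Y) :
    a * b ∈ toSubmodule X * toSubmodule Y :=
  Submodule.mul_mem_mul ha hb

theorem mul_left_mem_toSubmodule_mul {X Y : Subalgebra ℤ A} {a s : A} (ha : a ∈ X)
    (hs : s ∈ toSubmodule X * toSubmodule Y) : a * s ∈ toSubmodule X * toSubmodule Y := by
  induction hs using Submodule.mul_induction_on' with
  | mem_mul_mem u hu v hv =>
    rw [← mul_assoc]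
    exact mul_mem_toSubmodule_mul (X.mul_mem ha hu) hv
  | add u _ v _ hu hv => rw [mul_add]; exact add_mem hu hv

theorem mul_right_mem_toSubmodule_mul {X Y : Subalgebra ℤ A} {b s : A} (hb : b ∈ Y)
    (hs : s ∈ toSubmodule X * toSubmodule Y) : s * b ∈ toSubmodule X * toSubmodule Y := by
  induction hs using Submodule.mul_induction_on' with
  | mem_mul_mem u hu v hv =>
    rw [mul_assoc]
    exact mul_mem_toSubmodule_mul hu (Y.mul_mem hv hb)
  | add u _ v _ hu hv => rw [add_mul]; exact add_mem hu hv

theorem mul_mem_of_forall_generator {X : Subalgebra ℤ A} {S : Set A}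
    (h : ∀ s ∈ S, ∀ a ∈ X, s * a ∈ toSubmodule X * toSubmodule (Algebra.adjoin ℤ S))
    {b : A} (hb : b ∈ Algebra.adjoin ℤ S) :
    ∀ a ∈ X, b * a ∈ toSubmodule X * toSubmodule (Algebra.adjoin ℤ S) := by
  induction hb using Algebra.adjoin_induction with
  | mem s hs => exact h s hs
  | algebraMap r =>
    intro a ha
    rw [Algebra.commutes]
    exact mul_mem_toSubmodule_mul ha (Subalgebra.algebraMap_mem _ r)
  | add u v _ _ hu hv => intro a ha; rw [add_mul]; exact add_mem (hu a ha) (hv a ha)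
  | mul u v _ _ hu hv =>
    intro a ha
    rw [mul_assoc]
    have hva := hv a ha
    generalize v * a = w at hva
    induction hva using Submodule.mul_induction_on' with
    | mem_mul_mem a' ha' b' hb' =>
      rw [← mul_assoc]
      exact mul_right_mem_toSubmodule_mul hb' (hu a' ha')
    | add s _ t _ hs ht => rw [mul_add]; exact add_mem hs ht

theorem cEval_mem_toSubmodule_mul {X Y : Subalgebra ℤ A} {x y : ℕ+ → A}
    {q : MvPolynomial (ℕ+ ⊕ₗ ℕ+) ℤ} (hx : ∀ d, toLex (Sum.inl d) ∈ q.vars → x d ∈ X)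
    (hy : ∀ e, toLex (Sum.inr e) ∈ q.vars → y e ∈ Y) :
    cEval x y q ∈ toSubmodule X * toSubmodule Y := by
  have key (f : ℕ+ ⊕ₗ ℕ+ → ℕ) (l : List (ℕ+ ⊕ₗ ℕ+)) (hl : l.Pairwise (· ≤ ·))
      (hv : ∀ v ∈ l, v ∈ q.vars) :
      (l.map fun v => Sum.elim x y (ofLex v) ^ f v).prod ∈ toSubmodule X * toSubmodule Y := by
    induction l with
    | nil => simpa using mul_mem_toSubmodule_mul X.one_mem Y.one_mem
    | cons v l ih =>
      rw [List.pairwise_cons] at hl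
      rw [List.map_cons, List.prod_cons]
      obtain ⟨v, rfl⟩ := toLex.surjective v
      rcases v with d | e
      · exact mul_left_mem_toSubmodule_mul (X.pow_mem (hx d (hv _ (by simp))) _)
          (ih hl.2 fun v hvl => hv v (by simp [hvl]))
      · suffices h : (l.map fun v => Sum.elim x y (ofLex v) ^ f v).prod ∈ Y by
          simpa using mul_mem_toSubmodule_mul X.one_mem
            (Y.mul_mem (Y.pow_mem (hy e (hv _ (by simp))) (f (toLex (Sum.inr e)))) h)
        refine Y.list_prod_mem fun a ha => ?_
        obtain ⟨w, hw, rfl⟩ := List.mem_map.1 ha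
        have hle := hl.1 w hw
        have hwq := hv w (by simp [hw])
        obtain ⟨w, rfl⟩ := toLex.surjective w
        rcases w with d | e'
        · exact absurd hle (Sum.Lex.not_inr_le_inl)
        · exact Y.pow_mem (hy e' hwq) _
  refine Submodule.sum_mem _ fun e he => Submodule.smul_mem _ _ (key _ _ ?_ fun v hv => ?_)
  · exact Finset.pairwise_sort _ _
  · exact (MvPolynomial.mem_vars_iff_mem_support v).2 ⟨e, he, by simpa using hv⟩

/-- Every element is a sum of normally ordered products. -/
theorem IsBPair.toSubmodule_mul_eq_top {p m n : ℕ} [Fact p.Prime]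
    {c : ℕ+ → ℕ+ → MvPolynomial (ℕ+ ⊕ₗ ℕ+) ℤ} (hc : IsCFamily c) {x : Fin m → A} {y : Fin n → A}
    (h : IsBPair p c x y) (hgen : Algebra.adjoin ℤ (Set.range x ∪ Set.range y) = ⊤) :
    toSubmodule (Algebra.adjoin ℤ (Set.range x)) * toSubmodule (Algebra.adjoin ℤ (Set.range y)) =
      ⊤ := by
  set X := Algebra.adjoin ℤ (Set.range x) with hX
  let Y (j : ℕ) := Algebra.adjoin ℤ (y '' {k | (k : ℕ) < j})
  have hYmono {j j' : ℕ} (hj : j ≤ j') : Y j ≤ Y j' :=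
    Algebra.adjoin_mono (Set.image_mono fun k hk => lt_of_lt_of_le hk hj)
  have hxX (i : Fin m) : x i ∈ X := Algebra.subset_adjoin ⟨i, rfl⟩
  have hyY (k : Fin n) {j : ℕ} (hk : (k : ℕ) < j) : y k ∈ Y j := Algebra.subset_adjoin ⟨k, hk, rfl⟩
  have hcomm (j : Fin n) (hj : ∀ b ∈ Y j, ∀ a ∈ X, b * a ∈ toSubmodule X * toSubmodule (Y j))
      (a : A) (ha : a ∈ X) : y j * a - a * y j ∈ toSubmodule X * toSubmodule (Y j) := by
    induction ha using Algebra.adjoin_induction with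
    | mem _ hi =>
      obtain ⟨i, rfl⟩ := hi
      rw [h.yx, add_sub_cancel_left]
      refine cEval_mem_toSubmodule_mul (fun d _ => ?_) fun e he => ?_
      · unfold finExtend
        split_ifs
        exacts [hxX _, X.zero_mem]
      · obtain ⟨d, -, -, hv⟩ | ⟨d, hd, hne, hv⟩ := (hc _ _).1 _ he
        · simp at hv
        · obtain rfl : e = d := by simpa using hv
          obtain ⟨r, hr, rfl⟩ := exists_ppow_of_dvd hd hne
          rw [finExtend_padicValNat_ppow]
          unfold finExtend
          split_ifs
          exacts [hyY _ hr, (Y j).zero_mem]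
    | algebraMap r => rw [Algebra.commutes, sub_self]; exact zero_mem _
    | add u v _ _ hu hv =>
      rw [mul_add, add_mul, add_sub_add_comm]
      exact add_mem hu hv
    | mul u v hu' hv' hu hv =>
      have : y j * (u * v) - u * v * y j = (y j * u - u * y j) * v + u * (y j * v - v * y j) := by
        noncomm_ring
      rw [this]
      refine add_mem ?_ (mul_left_mem_toSubmodule_mul hu' hv)
      generalize y j * u - u * y j = w at hu
      induction hu using Submodule.mul_induction_on' with
      | mem_mul_mem a ha b hb =>
        rw [mul_assoc]
        exact mul_left_mem_toSubmodule_mul ha (hj b hb v hv')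
      | add s _ t _ hs ht => rw [add_mul]; exact add_mem hs ht
  have hYX (j : ℕ) : ∀ b ∈ Y j, ∀ a ∈ X, b * a ∈ toSubmodule X * toSubmodule (Y j) := by
    induction j using Nat.strong_induction_on with
    | _ j ih =>
      refine fun b hb => mul_mem_of_forall_generator ?_ hb
      rintro _ ⟨k, hk, rfl⟩ a ha
      rw [← sub_add_cancel (y k * a) (a * y k)]
      exact add_mem
        (mul_le_mul' le_rfl (Subalgebra.toSubmodule.monotone (hYmono hk.le)) (hcomm k (ih k hk) a ha))
        (mul_mem_toSubmodule_mul ha (hyY k hk))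
  have hYn : Y n = Algebra.adjoin ℤ (Set.range y) := by
    simp only [Y, Fin.is_lt, Set.ofPred_true, Set.image_univ]
  rw [← hYn, eq_top_iff]
  rintro b -
  have hb : b ∈ Algebra.adjoin ℤ (Set.range x ∪ Set.range y) := hgen ▸ Algebra.mem_top
  suffices ∀ s ∈ toSubmodule X * toSubmodule (Y n), b * s ∈ toSubmodule X * toSubmodule (Y n) by
    simpa using this _ (mul_mem_toSubmodule_mul X.one_mem (Y n).one_mem)
  induction hb using Algebra.adjoin_induction with
  | mem g hg =>
    intro s hs
    obtain ⟨i, rfl⟩ | ⟨j, rfl⟩ := hg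
    · exact mul_left_mem_toSubmodule_mul (hxX i) hs
    · induction hs using Submodule.mul_induction_on' with
      | mem_mul_mem u hu v hv =>
        rw [← mul_assoc]
        exact mul_right_mem_toSubmodule_mul hv (hYX n _ (hyY j j.2) u hu)
      | add u _ v _ hu hv => rw [mul_add]; exact add_mem hu hv
  | algebraMap r =>
    intro s hs
    rw [← Algebra.smul_def]
    exact Submodule.smul_mem _ _ hs
  | add u v _ _ hu hv => intro s hs; rw [add_mul]; exact add_mem (hu s hs) (hv s hs)
  | mul u v _ _ hu hv => intro s hs; rw [mul_assoc]; exact hu _ (hv s hs)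

end Spanning

section Model

open MvPolynomial

/-- The coefficient ring of the module on which the ghost relations are represented. -/
abbrev GhostCoeff : Type := MvPolynomial ℕ+ ℚ

/-- The module on which the ghost relations are represented. -/
abbrev GhostModule : Type := MvPolynomial ℕ+ GhostCoeff

/-- The ghost values of `x` act by multiplication. -/
def modelX (k : ℕ+) : Module.End GhostCoeff GhostModule := Algebra.lmul GhostCoeff GhostModule (X k)

theorem modelX_apply (k : ℕ+) (q : GhostModule) : modelX k q = X k * q := by
  rw [modelX, Algebra.coe_lmul_eq_mul, LinearMap.mul_apply_apply]

/-- The ghost values of `y` act by derivations shifted by scalars. -/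
def modelY (k : ℕ+) : Module.End GhostCoeff GhostModule :=
  (k : ℕ) • (pderiv k).toLinearMap + algebraMap GhostCoeff _ (ghost X k)

theorem pderiv_comm {σ R : Type*} [CommRing R] (i j : σ) (q : MvPolynomial σ R) :
    pderiv i (pderiv j q) = pderiv j (pderiv i q) := by
  classical
  have : ⁅pderiv (R := R) i, pderiv j⁆ = 0 := derivation_ext fun k => by
    rw [Derivation.commutator_apply, pderiv_X, pderiv_X]
    simp [Pi.single_apply, apply_ite]
  rw [← sub_eq_zero, ← Derivation.commutator_apply, this, Derivation.zero_apply]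

theorem isWeyl_model : IsWeyl modelX modelY where
  xx k l := (Commute.all (X k) (X l)).map (Algebra.lmul GhostCoeff GhostModule)
  yy k l := by
    refine Commute.add_left (Commute.add_right ?_ (Algebra.commutes _ _).symm)
      (Algebra.commutes _ _)
    refine Commute.smul_left (Commute.smul_right (LinearMap.ext fun q => ?_) _) _
    exact pderiv_comm k l q
  yx k l := by
    have h : (pderiv l).toLinearMap * modelX k = modelX k * (pderiv l).toLinearMap +
        if k = l then 1 else 0 := by
      refine LinearMap.ext fun q => ?_
      classical
      rw [Module.End.mul_apply, LinearMap.add_apply, Module.End.mul_apply, modelX_apply,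
        modelX_apply, Derivation.coeFn_coe, Derivation.leibniz,
        pderiv_X, smul_eq_mul, smul_eq_mul]
      split_ifs with hkl
      · subst hkl; simp
      · simp [Ne.symm hkl]
    rw [modelY, add_mul, mul_add, ← Algebra.commutes, smul_mul_assoc, h, mul_smul_comm, smul_add]
    split_ifs with hkl
    · subst hkl; simp; abel
    · simp

theorem unghost_modelX (d : ℕ+) :
    unghost modelX d = Algebra.lmul GhostCoeff GhostModule (unghost X d) := by
  have h : modelX = ⇑(Algebra.lmul GhostCoeff GhostModule).toRingHom ∘ X := funext fun k => rfl
  rw [h, ← map_unghost]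
  rfl

theorem pow_apply_one {o : Module.End GhostCoeff GhostModule} {a : GhostCoeff} (h : o 1 = C a)
    (r : ℕ) : (o ^ r) 1 = C (a ^ r) := by
  induction r with
  | zero => simp
  | succ r ih =>
    have : (C a : GhostModule) = a • 1 := by rw [smul_eq_C_mul, mul_one]
    rw [pow_succ, Module.End.mul_apply, h, this, map_smul, ih, smul_eq_C_mul, ← C_mul, pow_succ']

theorem unghost_modelY_apply_one (d : ℕ+) : unghost modelY d 1 = C (X d) := by
  induction d using PNat.strongInductionOn with
  | _ d ih =>
    have h : modelY d 1 = C (ghost X d) := by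
      simp [modelY, Algebra.algebraMap_eq_smul_one, smul_eq_C_mul]
    have hs : (∑ e ∈ (d : ℕ).properDivisors, (e : Module.End GhostCoeff GhostModule) *
        unghost modelY e.toPNat' ^ ((d : ℕ) / e)) 1 =
        C (∑ e ∈ (d : ℕ).properDivisors, (e : GhostCoeff) * X e.toPNat' ^ ((d : ℕ) / e)) := by
      rw [LinearMap.sum_apply, map_sum]
      refine Finset.sum_congr rfl fun e he => ?_
      rw [Module.End.mul_apply, pow_apply_one (ih _ (toPNat'_lt_of_mem_properDivisors he))]
      simp [← nsmul_eq_mul]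
    rw [unghost_eq, LinearMap.smul_apply, LinearMap.sub_apply, h, hs, ← C_sub, ghost_eq_add,
      add_sub_cancel_right, natCast_mul_eq_smul]
    rw [map_rat_smul, smul_smul, inv_mul_cancel₀ (by simp), one_smul]

open scoped TensorProduct in
open Subalgebra (toSubmodule) in
/-- A realisation of the relations of `B_{m,n}` by the model is faithful. -/
theorem IsBPair.injective_of_model {B : Type*} [Ring B] {p m n : ℕ} [hp : Fact p.Prime]
    {c : ℕ+ → ℕ+ → MvPolynomial (ℕ+ ⊕ₗ ℕ+) ℤ} (hc : IsCFamily c) {x : Fin m → B} {y : Fin n → B}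
    (h : IsBPair p c x y) (hgen : Algebra.adjoin ℤ (Set.range x ∪ Set.range y) = ⊤)
    (ρ : B →+* Module.End GhostCoeff GhostModule) (hx : ∀ i, ρ (x i) = unghost modelX (ppow p i))
    (hy : ∀ j, ρ (y j) = unghost modelY (ppow p j)) : Function.Injective ρ := by
  obtain ⟨F, hF, -⟩ := exists_algHom_eq_pEval h.xx
  obtain ⟨G, hG, -⟩ := exists_algHom_eq_pEval h.yy
  let N : MvPolynomial (Fin n) ℤ ⊗[ℤ] MvPolynomial (Fin m) ℤ →ₗ[ℤ] B :=
    TensorProduct.lift ((LinearMap.mul ℤ B).flip.compl₁₂ G.toLinearMap F.toLinearMap)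
  have hN g f : N (g ⊗ₜ f) = F f * G g := (TensorProduct.lift.tmul _ _).trans rfl
  have hsurj : Function.Surjective N := by
    rw [← LinearMap.range_eq_top, eq_top_iff, ← h.toSubmodule_mul_eq_top hc hgen, Submodule.mul_le]
    have hFr : Algebra.adjoin ℤ (Set.range x) ≤ F.range :=
      Algebra.adjoin_le (by rintro _ ⟨i, rfl⟩; exact ⟨X i, hF i⟩)
    have hGr : Algebra.adjoin ℤ (Set.range y) ≤ G.range :=
      Algebra.adjoin_le (by rintro _ ⟨i, rfl⟩; exact ⟨X i, hG i⟩)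
    intro a ha b hb
    obtain ⟨f, rfl⟩ := hFr ha
    obtain ⟨g, rfl⟩ := hGr hb
    exact ⟨g ⊗ₜ f, hN g f⟩
  have hpp : Function.Injective (ppow p) := fun i j hij => by
    have := congrArg PNat.val hij
    simpa [ppow, hp.out.pos, Nat.pow_right_inj hp.out.two_le] using this
  let j : MvPolynomial (Fin n) ℤ →+* GhostCoeff :=
    (rename (R := ℚ) fun i : Fin n => ppow p i).toRingHom.comp (MvPolynomial.map (Int.castRingHom ℚ))
  have hj : Function.Injective j :=
    (rename_injective _ (hpp.comp Fin.val_injective)).comp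
      (MvPolynomial.map_injective _ Int.cast_injective)
  have hG1 g : ρ (G g) 1 = C (j g) := by
    induction g using MvPolynomial.induction_on with
    | C a => simp [j]
    | add f g hf hg => simp only [map_add, LinearMap.add_apply, hf, hg]
    | mul_X g i hg =>
      have : (C (X (ppow p i)) : GhostModule) = (X (ppow p i) : GhostCoeff) • 1 := by
        rw [smul_eq_C_mul, mul_one]
      rw [map_mul, map_mul, hG, hy, Module.End.mul_apply, unghost_modelY_apply_one, this,
        map_smul, hg, smul_eq_C_mul, ← C_mul, mul_comm]
      simp [j]
  let ξ : MvPolynomial (Fin m) ℤ →+* GhostModule :=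
    (aeval fun i : Fin m => unghost (X : ℕ+ → GhostModule) (ppow p i)).toRingHom
  have hF1 f : ρ (F f) = Algebra.lmul GhostCoeff GhostModule (ξ f) := by
    have : ρ.comp F.toRingHom = (Algebra.lmul GhostCoeff GhostModule).toRingHom.comp ξ := by
      refine ringHom_ext' (Subsingleton.elim _ _) fun i => ?_
      simp [hF, hx, unghost_modelX, ξ]
    exact congrArg (· f) this
  let ψ : GhostModule →ₐ[GhostCoeff] GhostModule := aeval (ghost X)
  have hψ d : ψ (unghost X d) = X d := by
    refine (map_unghost ψ.toRingHom X d).trans ?_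
    rw [← unghost_ghost (X : ℕ+ → GhostModule)]
    congr 1
    exact funext fun k => aeval_X _ _
  let κ : MvPolynomial (Fin m) (MvPolynomial (Fin n) ℤ) →+* GhostModule :=
    (rename (R := GhostCoeff) fun i : Fin m => ppow p i).toRingHom.comp (MvPolynomial.map j)
  have hκ : Function.Injective κ :=
    (rename_injective _ (hpp.comp Fin.val_injective)).comp (MvPolynomial.map_injective _ hj)
  have hκξ f : κ (MvPolynomial.map (algebraMap _ _) f) = ψ (ξ f) := by
    have : κ.comp (MvPolynomial.map (algebraMap ℤ (MvPolynomial (Fin n) ℤ))) =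
        ψ.toRingHom.comp ξ := by
      refine ringHom_ext' (Subsingleton.elim _ _) fun i => ?_
      simp [ξ, κ, hψ]
    exact congrArg (· f) this
  have key t : ψ (ρ (N t) 1) = κ (algebraTensorAlgEquiv ℤ (MvPolynomial (Fin n) ℤ) t) := by
    induction t using TensorProduct.induction_on with
    | zero => simp
    | add s t hs ht => simp only [map_add, LinearMap.add_apply, hs, ht]
    | tmul g f =>
      rw [hN, map_mul, Module.End.mul_apply, hG1, hF1, algebraTensorAlgEquiv_tmul, smul_eq_C_mul,
        map_mul, hκξ, Algebra.coe_lmul_eq_mul, LinearMap.mul_apply_apply, map_mul, mul_comm]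
      simp [κ, ψ]
  rw [injective_iff_map_eq_zero]
  intro b hb
  obtain ⟨t, rfl⟩ := hsurj b
  have := key t
  rw [hb, LinearMap.zero_apply, map_zero, eq_comm, map_eq_zero_iff κ hκ,
    EmbeddingLike.map_eq_zero_iff] at this
  rw [this, map_zero]

end Model

section Universal

variable {R : Type*} [CommRing R] {A : Type*} [Ring A] [Algebra R A] {p m n : ℕ}
  {c : ℕ+ → ℕ+ → MvPolynomial (ℕ+ ⊕ₗ ℕ+) ℤ}

theorem isBPair_generators : IsBPair p c (gx R p c m n) (gy R p c m n) where
  xx i i' := by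
    have h := RingQuot.mkAlgHom_rel R (BmnRel.xx (R := R) (p := p) (c := c) (n := n) i i')
    rwa [map_mul, map_mul] at h
  yy j j' := by
    have h := RingQuot.mkAlgHom_rel R (BmnRel.yy (R := R) (p := p) (c := c) (m := m) j j')
    rwa [map_mul, map_mul] at h
  yx i j := by
    have h := RingQuot.mkAlgHom_rel R (BmnRel.yx (R := R) (p := p) (c := c) i j)
    rw [map_mul, map_add, map_mul] at h
    refine h.trans (congrArg (HAdd.hAdd _) ?_)
    exact map_cEval_finExtend (RingQuot.mkAlgHom R (BmnRel R p c m n)).toRingHom p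
      (fun i => FreeAlgebra.ι R (Sum.inl i)) (fun j => FreeAlgebra.ι R (Sum.inr j)) _

theorem Bmn.algHom_ext {A : Type*} [Semiring A] [Algebra R A] {f g : Bmn R p c m n →ₐ[R] A}
    (hx : ∀ i, f (gx R p c m n i) = g (gx R p c m n i))
    (hy : ∀ j, f (gy R p c m n j) = g (gy R p c m n j)) : f = g :=
  RingQuot.ringQuot_ext' _ _ _ (FreeAlgebra.hom_ext (funext (Sum.rec hx hy)))

theorem IsBPair.exists_algHom {x : Fin m → A} {y : Fin n → A} (h : IsBPair p c x y) :
    ∃ f : Bmn R p c m n →ₐ[R] A,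
      (∀ i, f (gx R p c m n i) = x i) ∧ ∀ j, f (gy R p c m n j) = y j := by
  let f : FreeAlgebra R (Fin m ⊕ Fin n) →ₐ[R] A := FreeAlgebra.lift R (Sum.elim x y)
  have hfx : ⇑f ∘ (fun i => FreeAlgebra.ι R (Sum.inl i)) = x := funext fun i => by simp [f]
  have hfy : ⇑f ∘ (fun j => FreeAlgebra.ι R (Sum.inr j)) = y := funext fun j => by simp [f]
  have hf : ∀ ⦃a b⦄, BmnRel R p c m n a b → f a = f b := by
    rintro _ _ (⟨i, i'⟩ | ⟨j, j'⟩ | ⟨i, j⟩)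
    · simpa [f] using (h.xx i i').eq
    · simpa [f] using (h.yy j j').eq
    · have hc := map_cEval_finExtend f.toRingHom p (fun i => FreeAlgebra.ι R (Sum.inl i))
        (fun j => FreeAlgebra.ι R (Sum.inr j)) (c (ppow p i) (ppow p j))
      have key := h.yx i j
      rw [← hfx, ← hfy] at key
      rw [map_mul, map_add, map_mul]
      exact key.trans (congrArg _ hc.symm)
  refine ⟨RingQuot.liftAlgHom R ⟨f, hf⟩, fun i => ?_, fun j => ?_⟩
  · exact (RingQuot.liftAlgHom_mkAlgHom_apply R f hf _).trans (by simp [f])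
  · exact (RingQuot.liftAlgHom_mkAlgHom_apply R f hf _).trans (by simp [f])

theorem Bmn.adjoin_generators :
    Algebra.adjoin R (Set.range (gx R p c m n) ∪ Set.range (gy R p c m n)) = ⊤ := by
  rw [eq_top_iff]
  rintro b -
  obtain ⟨a, rfl⟩ := RingQuot.mkAlgHom_surjective R (BmnRel R p c m n) b
  induction a using FreeAlgebra.induction with
  | grade0 r => rw [AlgHom.commutes]; exact Subalgebra.algebraMap_mem _ r
  | grade1 v =>
    refine Algebra.subset_adjoin ?_
    rcases v with i | j
    exacts [Or.inl ⟨i, rfl⟩, Or.inr ⟨j, rfl⟩]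
  | mul a b ha hb => rw [map_mul]; exact mul_mem ha hb
  | add a b ha hb => rw [map_add]; exact add_mem ha hb

variable (R p c m n) in
/-- The relations hold for the generators of `B_{m,n}(R) ⊗ B_{m,n}(R)`. -/
theorem isBQuad_generators :
    IsBQuad p c (fun i => gx R p c m n i ⊗ₜ[R] (1 : Bmn R p c m n))
      (fun j => gy R p c m n j ⊗ₜ[R] (1 : Bmn R p c m n))
      (fun i => (1 : Bmn R p c m n) ⊗ₜ[R] gx R p c m n i)
      (fun j => (1 : Bmn R p c m n) ⊗ₜ[R] gy R p c m n j) where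
  left := by
    have h := (isBPair_generators (R := R) (p := p) (c := c) (m := m) (n := n)).map
      (A' := Bmn R p c m n ⊗[R] Bmn R p c m n)
      (Algebra.TensorProduct.includeLeft (R := R) (S := R) (A := Bmn R p c m n)
        (B := Bmn R p c m n)).toRingHom
    exact h
  right := by
    have h := (isBPair_generators (R := R) (p := p) (c := c) (m := m) (n := n)).map
      (A' := Bmn R p c m n ⊗[R] Bmn R p c m n)
      (Algebra.TensorProduct.includeRight (R := R) (A := Bmn R p c m n)
        (B := Bmn R p c m n)).toRingHom
    exact h
  xz i i' := by simp [commute_iff_eq]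
  xt i j := by simp [commute_iff_eq]
  yz j i := by simp [commute_iff_eq]
  yt j j' := by simp [commute_iff_eq]

theorem Bmn.tensor_algHom_ext {A : Type*} [Semiring A] [Algebra R A]
    {f g : Bmn R p c m n ⊗[R] Bmn R p c m n →ₐ[R] A}
    (hx : ∀ i, f (gx R p c m n i ⊗ₜ[R] 1) = g (gx R p c m n i ⊗ₜ[R] 1))
    (hy : ∀ j, f (gy R p c m n j ⊗ₜ[R] 1) = g (gy R p c m n j ⊗ₜ[R] 1))
    (hz : ∀ i, f (1 ⊗ₜ[R] gx R p c m n i) = g (1 ⊗ₜ[R] gx R p c m n i))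
    (ht : ∀ j, f (1 ⊗ₜ[R] gy R p c m n j) = g (1 ⊗ₜ[R] gy R p c m n j)) : f = g :=
  Algebra.TensorProduct.ext (Bmn.algHom_ext hx hy) (Bmn.algHom_ext hz ht)

theorem Bmn.commute_algHom {a : A}
    {f : Bmn R p c m n →ₐ[R] A} (hx : ∀ i, Commute a (f (gx R p c m n i)))
    (hy : ∀ j, Commute a (f (gy R p c m n j))) (b : Bmn R p c m n) : Commute a (f b) := by
  have hb : b ∈ Algebra.adjoin R (Set.range (gx R p c m n) ∪ Set.range (gy R p c m n)) := by
    rw [Bmn.adjoin_generators]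
    exact Algebra.mem_top
  induction hb using Algebra.adjoin_induction with
  | mem b hb => obtain ⟨i, rfl⟩ | ⟨j, rfl⟩ := hb; exacts [hx i, hy j]
  | algebraMap r => rw [AlgHom.commutes]; exact (Algebra.commutes r a).symm
  | add b b' _ _ h h' => rw [map_add]; exact h.add_right h'
  | mul b b' _ _ h h' => rw [map_mul]; exact h.mul_right h'

theorem IsBQuad.exists_algHom {x z : Fin m → A} {y t : Fin n → A} (h : IsBQuad p c x y z t) :
    ∃ f : Bmn R p c m n ⊗[R] Bmn R p c m n →ₐ[R] A,
      (∀ i, f (gx R p c m n i ⊗ₜ[R] 1) = x i) ∧ (∀ j, f (gy R p c m n j ⊗ₜ[R] 1) = y j) ∧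
      (∀ i, f (1 ⊗ₜ[R] gx R p c m n i) = z i) ∧ ∀ j, f (1 ⊗ₜ[R] gy R p c m n j) = t j := by
  obtain ⟨f, hfx, hfy⟩ := h.left.exists_algHom (R := R)
  obtain ⟨g, hgz, hgt⟩ := h.right.exists_algHom (R := R)
  have hfg a b : Commute (f a) (g b) := by
    refine Bmn.commute_algHom (fun i => ?_) (fun j => ?_) b
    · refine (Bmn.commute_algHom (fun i' => ?_) (fun j => ?_) a).symm
      · rw [hfx, hgz]; exact (h.xz _ _).symm
      · rw [hfy, hgz]; exact (h.yz _ _).symm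
    · refine (Bmn.commute_algHom (fun i => ?_) (fun j' => ?_) a).symm
      · rw [hfx, hgt]; exact (h.xt _ _).symm
      · rw [hfy, hgt]; exact (h.yt _ _).symm
  exact ⟨Algebra.TensorProduct.lift f g hfg, by simp [hfx], by simp [hfy], by simp [hgz],
    by simp [hgt]⟩

end Universal

section Faithful

variable {p m n : ℕ} [hp : Fact p.Prime] {c : ℕ+ → ℕ+ → MvPolynomial (ℕ+ ⊕ₗ ℕ+) ℤ}

theorem adjoin_int_congr {B : Type*} [Ring B] (i₁ i₂ : Algebra ℤ B) {s : Set B}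
    (h : @Algebra.adjoin ℤ B _ _ i₁ s = ⊤) : @Algebra.adjoin ℤ B _ _ i₂ s = ⊤ := by
  obtain rfl : i₁ = i₂ := Subsingleton.elim _ _
  exact h

/-- `B_{m,n}(ℤ)` embeds into a `ℚ`-algebra in which its generators have ghost values satisfying the
Weyl relations. -/
theorem exists_injective_ringHom (m n : ℕ) (hc : IsCFamily c) :
    ∃ (E : Type) (_ : Ring E) (_ : Algebra ℚ E) (X Y : ℕ+ → E) (ρ : Bmn ℤ p c m n →ₐ[ℤ] E),
      IsWeyl X Y ∧ Function.Injective ρ ∧ (∀ i, ρ (gx ℤ p c m n i) = unghost X (ppow p i)) ∧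
      ∀ j, ρ (gy ℤ p c m n j) = unghost Y (ppow p j) := by
  obtain ⟨ρ, hx, hy⟩ := (isWeyl_model.isBPair (p := p) (m := m) (n := n) hc).exists_algHom (R := ℤ)
  refine ⟨Module.End GhostCoeff GhostModule, inferInstance, inferInstance, modelX, modelY, ρ,
    isWeyl_model, ?_, hx, hy⟩
  refine isBPair_generators.injective_of_model hc ?_ ρ.toRingHom hx hy
  exact adjoin_int_congr _ _ Bmn.adjoin_generators

/-- Two commuting pairs of families satisfying the Weyl relations. -/
structure IsWeylQuad {A : Type*} [Ring A] (X Y Z T : ℕ+ → A) : Prop where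
  left : IsWeyl X Y
  right : IsWeyl Z T
  xz : ∀ k l, Commute (X k) (Z l)
  xt : ∀ k l, Commute (X k) (T l)
  yz : ∀ k l, Commute (Y k) (Z l)
  yt : ∀ k l, Commute (Y k) (T l)

theorem IsWeyl.map {A A' : Type*} [Ring A] [Ring A'] {X Y : ℕ+ → A} (h : IsWeyl X Y)
    (f : A →+* A') : IsWeyl (f ∘ X) (f ∘ Y) where
  xx k l := (h.xx k l).map f
  yy k l := (h.yy k l).map f
  yx k l := by
    rw [Function.comp_apply, Function.comp_apply, ← map_mul, h.yx, map_add, map_mul]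
    split_ifs <;> simp

section

variable {A : Type*} [Ring A] {X Y Z T : ℕ+ → A}

theorem IsWeylQuad.shear (h : IsWeylQuad X Y Z T) (ε : ℤ) :
    IsWeylQuad (fun k => X k + ε * Z k) Y Z (fun l => T l + (-ε : ℤ) * Y l) where
  left :=
    { xx := fun k l => by
        refine .add_left (.add_right (h.left.xx k l) ?_) (.add_right ?_ ?_)
        · exact (Int.commute_cast _ _).mul_right (h.xz k l)
        · exact (Int.cast_commute _ _).mul_left (h.xz l k).symm
        · exact (Int.cast_commute _ _).mul_left ((Int.commute_cast _ _).mul_right (h.right.xx k l))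
      yy := h.left.yy
      yx := fun k l => by
        have hz := (Int.commute_cast (Y l) ε).mul_right (h.yz l k)
        rw [mul_add, add_mul, h.left.yx, hz.eq, add_right_comm] }
  right :=
    { xx := h.right.xx
      yy := fun k l => by
        refine .add_left (.add_right (h.right.yy k l) ?_) (.add_right ?_ ?_)
        · exact (Int.commute_cast _ _).mul_right (h.yt l k).symm
        · exact (Int.cast_commute _ _).mul_left (h.yt k l)
        · exact (Int.cast_commute _ _).mul_left ((Int.commute_cast _ _).mul_right (h.left.yy k l))
      yx := fun k l => by
        have hz := (Int.cast_commute (-ε) (Z k)).mul_left (h.yz l k)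
        rw [mul_add, add_mul, h.right.yx, hz.eq, add_right_comm] }
  xz k l := (h.xz k l).add_left ((Int.cast_commute _ _).mul_left (h.right.xx k l))
  xt k l := by
    have h1 : Y l * X k - X k * Y l = T l * Z k - Z k * T l := by
      rw [h.left.yx, h.right.yx, add_sub_cancel_left, add_sub_cancel_left]
    have h2 : X k * T l - T l * X k = 0 := sub_eq_zero.2 (h.xt k l).eq
    have h3 : Y l * Z k - Z k * Y l = 0 := sub_eq_zero.2 (h.yz l k).eq
    rw [commute_iff_eq, ← sub_eq_zero]
    simp only [← zsmul_eq_mul, add_mul, mul_add, smul_mul_assoc, mul_smul_comm]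
    linear_combination (norm := module) h2 + ε • h1 + (ε * ε) • h3
  yz := h.yz
  yt k l := (h.yt k l).add_right ((Int.commute_cast _ _).mul_right (h.left.yy k l))

variable [Algebra ℚ A]

theorem IsWeylQuad.isBQuad (h : IsWeylQuad X Y Z T) (hc : IsCFamily c) :
    IsBQuad p c (fun i : Fin m => unghost X (ppow p i)) (fun j : Fin n => unghost Y (ppow p j))
      (fun i => unghost Z (ppow p i)) (fun j => unghost T (ppow p j)) where
  left := h.left.isBPair hc
  right := h.right.isBPair hc
  xz _ _ := commute_unghost h.xz _ _
  xt _ _ := commute_unghost h.xt _ _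
  yz _ _ := commute_unghost h.yz _ _
  yt _ _ := commute_unghost h.yt _ _

end

open scoped TensorProduct

theorem tensorProductMap_injective {R B E : Type*} [CommRing R] [IsDedekindDomain R]
    [Ring B] [Algebra R B] [Ring E] [Algebra R E] [Module.IsTorsionFree R E]
    {ρ : B →ₐ[R] E} (hρ : Function.Injective ρ) :
    Function.Injective (Algebra.TensorProduct.map ρ ρ) := by
  have : Module.IsTorsionFree R B := hρ.moduleIsTorsionFree _ fun a b => map_smul ρ a b
  exact TensorProduct.map_injective_of_flat_flat ρ.toLinearMap ρ.toLinearMap hρ hρ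

/-- `B_{m,n}(ℤ) ⊗ B_{m,n}(ℤ)` embeds into a `ℚ`-algebra in which its generators have ghost values
satisfying the Weyl relations. -/
theorem exists_injective_ringHom_tensor (m n : ℕ) (hc : IsCFamily c) :
    ∃ (E : Type) (_ : Ring E) (_ : Algebra ℚ E) (X Y Z T : ℕ+ → E)
      (ρ : Bmn ℤ p c m n ⊗[ℤ] Bmn ℤ p c m n →+* E),
      IsWeylQuad X Y Z T ∧ Function.Injective ρ ∧
      (∀ i, ρ (gx ℤ p c m n i ⊗ₜ[ℤ] 1) = unghost X (ppow p i)) ∧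
      (∀ j, ρ (gy ℤ p c m n j ⊗ₜ[ℤ] 1) = unghost Y (ppow p j)) ∧
      (∀ i, ρ (1 ⊗ₜ[ℤ] gx ℤ p c m n i) = unghost Z (ppow p i)) ∧
      ∀ j, ρ (1 ⊗ₜ[ℤ] gy ℤ p c m n j) = unghost T (ppow p j) := by
  obtain ⟨E, _, _, X, Y, ρ, hXY, hρ, hx, hy⟩ := exists_injective_ringHom (p := p) m n hc
  have : Module.IsTorsionFree ℤ E := .trans_faithfulSMul ℤ ℚ E
  let L : E →+* E ⊗[ℤ] E := (Algebra.TensorProduct.includeLeft : E →ₐ[ℤ] E ⊗[ℤ] E).toRingHom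
  let R : E →+* E ⊗[ℤ] E := (Algebra.TensorProduct.includeRight : E →ₐ[ℤ] E ⊗[ℤ] E).toRingHom
  have hLR a b : Commute (L a) (R b) := by simp [L, R, commute_iff_eq]
  refine ⟨E ⊗[ℤ] E, inferInstance, inferInstance, L ∘ X, L ∘ Y, R ∘ X, R ∘ Y,
    (Algebra.TensorProduct.map ρ ρ).toRingHom,
    ⟨hXY.map L, hXY.map R, fun _ _ => hLR _ _, fun _ _ => hLR _ _, fun _ _ => hLR _ _,
      fun _ _ => hLR _ _⟩, tensorProductMap_injective hρ, ?_, ?_, ?_, ?_⟩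
  · exact fun i => (Algebra.TensorProduct.map_tmul ρ ρ _ _).trans
      (by rw [hx, map_one]; exact map_unghost L X _)
  · exact fun j => (Algebra.TensorProduct.map_tmul ρ ρ _ _).trans
      (by rw [hy, map_one]; exact map_unghost L Y _)
  · exact fun i => (Algebra.TensorProduct.map_tmul ρ ρ _ _).trans
      (by rw [hx, map_one]; exact map_unghost R X _)
  · exact fun j => (Algebra.TensorProduct.map_tmul ρ ρ _ _).trans
      (by rw [hy, map_one]; exact map_unghost R Y _)

end Faithful

section Shear

variable {p m n : ℕ} [hp : Fact p.Prime] {c : ℕ+ → ℕ+ → MvPolynomial (ℕ+ ⊕ₗ ℕ+) ℤ}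
  {A A' : Type*} [Ring A] [Ring A']

theorem comp_wittComb (f : A →+* A') (ε : ℤ) (x z : Fin m → A) :
    f ∘ wittComb p ε x z = wittComb p ε (f ∘ x) (f ∘ z) :=
  funext fun i => map_wittComb f p ε x z i

/-- The shear `x ↦ x + ε z`, `t ↦ t - ε y` preserves the defining relations, and the shear with
parameter `-ε` reverts it. -/
structure ShearProperty (p : ℕ) [Fact p.Prime] (c : ℕ+ → ℕ+ → MvPolynomial (ℕ+ ⊕ₗ ℕ+) ℤ) (ε : ℤ)
    (x : Fin m → A) (y : Fin n → A) (z : Fin m → A) (t : Fin n → A) : Prop where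
  isBQuad : IsBQuad p c (wittComb p ε x z) y z (wittComb p (-ε) t y)
  left_cancel : wittComb p (-ε) (wittComb p ε x z) z = x
  right_cancel : wittComb p ε (wittComb p (-ε) t y) y = t

theorem ShearProperty.map {ε : ℤ} {x z : Fin m → A} {y t : Fin n → A}
    (h : ShearProperty p c ε x y z t) (f : A →+* A') :
    ShearProperty p c ε (f ∘ x) (f ∘ y) (f ∘ z) (f ∘ t) where
  isBQuad := by simpa only [comp_wittComb] using h.isBQuad.map f
  left_cancel := by simpa only [comp_wittComb] using congrArg (f ∘ ·) h.left_cancel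
  right_cancel := by simpa only [comp_wittComb] using congrArg (f ∘ ·) h.right_cancel

theorem ShearProperty.of_map {ε : ℤ} {x z : Fin m → A} {y t : Fin n → A} {f : A →+* A'}
    (hf : Function.Injective f) (h : ShearProperty p c ε (f ∘ x) (f ∘ y) (f ∘ z) (f ∘ t)) :
    ShearProperty p c ε x y z t where
  isBQuad := .of_map hf (by simpa only [comp_wittComb] using h.isBQuad)
  left_cancel := hf.comp_left (by simpa only [comp_wittComb] using h.left_cancel)
  right_cancel := hf.comp_left (by simpa only [comp_wittComb] using h.right_cancel)

theorem IsWeylQuad.shearProperty [Algebra ℚ A] {X Y Z T : ℕ+ → A} (h : IsWeylQuad X Y Z T)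
    (hc : IsCFamily c) (ε : ℤ) :
    ShearProperty p c ε (fun i : Fin m => unghost X (ppow p i))
      (fun j : Fin n => unghost Y (ppow p j)) (fun i => unghost Z (ppow p i))
      (fun j => unghost T (ppow p j)) := by
  have h' := h.shear ε
  have hx := funext (wittComb_unghost (m := m) p ε h.left.xx h.xz h.right.xx)
  have ht := funext (wittComb_unghost (m := n) p (-ε) h.right.yy
    (fun k l => (h.yt l k).symm) h.left.yy)
  refine ⟨?_, ?_, ?_⟩
  · rw [hx, ht]
    exact h'.isBQuad hc
  · rw [hx, funext (wittComb_unghost (m := m) p (-ε) h'.left.xx h'.xz h'.right.xx)]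
    simp
  · rw [ht, funext (wittComb_unghost (m := n) p ε h'.right.yy
      (fun k l => (h'.yt l k).symm) h'.left.yy)]
    simp

open scoped TensorProduct

theorem IsWeylQuad.shearProperty_generators {R E : Type*} [CommRing R] [Ring E] [Algebra ℚ E]
    {X Y Z T : ℕ+ → E} (h : IsWeylQuad X Y Z T) (hc : IsCFamily c) (ε : ℤ)
    {ρ : Bmn R p c m n ⊗[R] Bmn R p c m n →+* E} (hρ : Function.Injective ρ)
    (hx : ∀ i, ρ (gx R p c m n i ⊗ₜ[R] 1) = unghost X (ppow p i))
    (hy : ∀ j, ρ (gy R p c m n j ⊗ₜ[R] 1) = unghost Y (ppow p j))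
    (hz : ∀ i, ρ (1 ⊗ₜ[R] gx R p c m n i) = unghost Z (ppow p i))
    (ht : ∀ j, ρ (1 ⊗ₜ[R] gy R p c m n j) = unghost T (ppow p j)) :
    ShearProperty p c ε (fun i => gx R p c m n i ⊗ₜ[R] (1 : Bmn R p c m n))
      (fun j => gy R p c m n j ⊗ₜ[R] (1 : Bmn R p c m n))
      (fun i => (1 : Bmn R p c m n) ⊗ₜ[R] gx R p c m n i)
      (fun j => (1 : Bmn R p c m n) ⊗ₜ[R] gy R p c m n j) := by
  refine .of_map hρ ?_
  convert h.shearProperty (p := p) hc ε using 1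
  exacts [funext hx, funext hy, funext hz, funext ht]

theorem IsBQuad.shearProperty {x z : Fin m → A} {y t : Fin n → A} (h : IsBQuad p c x y z t)
    (hc : IsCFamily c) (ε : ℤ) : ShearProperty p c ε x y z t := by
  obtain ⟨E, _, _, X, Y, Z, T, ρ, hW, hρ, hx, hy, hz, ht⟩ :=
    exists_injective_ringHom_tensor (p := p) m n hc
  obtain ⟨f, hfx, hfy, hfz, hft⟩ := h.exists_algHom (R := ℤ)
  convert (hW.shearProperty_generators hc ε hρ hx hy hz ht).map f.toRingHom using 1
  exacts [funext fun i => (hfx i).symm, funext fun j => (hfy j).symm,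
    funext fun i => (hfz i).symm, funext fun j => (hft j).symm]

/-- The endomorphism `x ↦ x + ε z`, `t ↦ t - ε y` of `B_{m,n}(R) ⊗ B_{m,n}(R)`. -/
theorem exists_shear_algHom (R : Type*) [CommRing R] (m n : ℕ) (hc : IsCFamily c) (ε : ℤ) :
    ∃ f : Bmn R p c m n ⊗[R] Bmn R p c m n →ₐ[R] Bmn R p c m n ⊗[R] Bmn R p c m n,
      (∀ i, f (gx R p c m n i ⊗ₜ[R] 1) = wittComb p ε (fun i => gx R p c m n i ⊗ₜ[R] 1)
        (fun i => 1 ⊗ₜ[R] gx R p c m n i) i) ∧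
      (∀ j, f (gy R p c m n j ⊗ₜ[R] 1) = gy R p c m n j ⊗ₜ[R] 1) ∧
      (∀ i, f (1 ⊗ₜ[R] gx R p c m n i) = 1 ⊗ₜ[R] gx R p c m n i) ∧
      ∀ j, f (1 ⊗ₜ[R] gy R p c m n j) = wittComb p (-ε) (fun j => 1 ⊗ₜ[R] gy R p c m n j)
        (fun j => gy R p c m n j ⊗ₜ[R] 1) j :=
  ((isBQuad_generators R p m n c).shearProperty hc ε).isBQuad.exists_algHom

theorem shear_comp_shear (R : Type*) [CommRing R] (hc : IsCFamily c) {ε δ : ℤ}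
    (hδ : -ε = δ)
    {f g : Bmn R p c m n ⊗[R] Bmn R p c m n →ₐ[R] Bmn R p c m n ⊗[R] Bmn R p c m n}
    (hfx : ∀ i, f (gx R p c m n i ⊗ₜ[R] 1) = wittComb p ε (fun i => gx R p c m n i ⊗ₜ[R] 1)
        (fun i => 1 ⊗ₜ[R] gx R p c m n i) i)
    (hfy : ∀ j, f (gy R p c m n j ⊗ₜ[R] 1) = gy R p c m n j ⊗ₜ[R] 1)
    (hfz : ∀ i, f (1 ⊗ₜ[R] gx R p c m n i) = 1 ⊗ₜ[R] gx R p c m n i)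
    (hft : ∀ j, f (1 ⊗ₜ[R] gy R p c m n j) = wittComb p (-ε) (fun j => 1 ⊗ₜ[R] gy R p c m n j)
        (fun j => gy R p c m n j ⊗ₜ[R] 1) j)
    (hgx : ∀ i, g (gx R p c m n i ⊗ₜ[R] 1) = wittComb p δ (fun i => gx R p c m n i ⊗ₜ[R] 1)
        (fun i => 1 ⊗ₜ[R] gx R p c m n i) i)
    (hgy : ∀ j, g (gy R p c m n j ⊗ₜ[R] 1) = gy R p c m n j ⊗ₜ[R] 1)
    (hgz : ∀ i, g (1 ⊗ₜ[R] gx R p c m n i) = 1 ⊗ₜ[R] gx R p c m n i)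
    (hgt : ∀ j, g (1 ⊗ₜ[R] gy R p c m n j) = wittComb p (-δ) (fun j => 1 ⊗ₜ[R] gy R p c m n j)
        (fun j => gy R p c m n j ⊗ₜ[R] 1) j) :
    f.comp g = AlgHom.id R _ := by
  subst hδ
  have h := (isBQuad_generators R p m n c).shearProperty hc ε
  refine Bmn.tensor_algHom_ext (fun i => ?_) (fun j => ?_) (fun i => ?_) (fun j => ?_)
  · rw [AlgHom.comp_apply, hgx]
    refine (map_wittComb (A := Bmn R p c m n ⊗[R] Bmn R p c m n) f.toRingHom p _ _ _
      i).trans (Eq.trans ?_ (congrFun h.left_cancel i))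
    exact congrArg₂ (wittComb p (-ε) · · i) (funext hfx) (funext hfz)
  · rw [AlgHom.comp_apply, hgy, hfy, AlgHom.id_apply]
  · rw [AlgHom.comp_apply, hgz, hfz, AlgHom.id_apply]
  · rw [AlgHom.comp_apply, hgt, neg_neg]
    refine (map_wittComb (A := Bmn R p c m n ⊗[R] Bmn R p c m n) f.toRingHom p _ _ _
      j).trans (Eq.trans ?_ (congrFun h.right_cancel j))
    exact congrArg₂ (wittComb p ε · · j) (funext hft) (funext hfy)

end Shear

/-- Fix a prime `p`, `m, n ∈ ℕ` and a commutative ring `R`.  Writing `x, y` for the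
generators of the first tensor factor of `B_{m,n}(R) ⊗_R B_{m,n}(R)` and `z, t` for those
of the second, there is an `R`-algebra automorphism of `B_{m,n}(R) ⊗_R B_{m,n}(R)`
sending `x ↦ x + z`, `y ↦ y`, `z ↦ z` and `t ↦ t − y`, where the sum `x + z` and the
difference `t − y` of truncated `p`-typical Witt vectors are computed componentwise by the
universal integral Witt addition/subtraction polynomials.  In other words,
`B_{m,n}(R)(x,y) ⊗_R B_{m,n}(R)(z,t) = B_{m,n}(R)(x+z, y) ⊗_R B_{m,n}(R)(z, t−y)`. -/
theorem bmn_tensor_automorphism (p : ℕ) [Fact p.Prime] (R : Type*) [CommRing R]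
    (m n : ℕ) (c : ℕ+ → ℕ+ → MvPolynomial (ℕ+ ⊕ₗ ℕ+) ℤ) (hc : IsCFamily c) :
    ∃ φ : (Bmn R p c m n ⊗[R] Bmn R p c m n) ≃ₐ[R] (Bmn R p c m n ⊗[R] Bmn R p c m n),
      (∀ i : Fin m, φ (gx R p c m n i ⊗ₜ[R] 1) =
        pEval (addSubstXZ R p c m n)
          (MvPolynomial.rename (toLex : Fin 2 × ℕ → Fin 2 ×ₗ ℕ) (WittVector.wittAdd p i))) ∧
      (∀ j : Fin n, φ (gy R p c m n j ⊗ₜ[R] 1) = gy R p c m n j ⊗ₜ[R] 1) ∧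
      (∀ i : Fin m, φ ((1 : Bmn R p c m n) ⊗ₜ[R] gx R p c m n i) =
        (1 : Bmn R p c m n) ⊗ₜ[R] gx R p c m n i) ∧
      (∀ j : Fin n, φ ((1 : Bmn R p c m n) ⊗ₜ[R] gy R p c m n j) =
        pEval (subSubstTY R p c m n)
          (MvPolynomial.rename (toLex : Fin 2 × ℕ → Fin 2 ×ₗ ℕ) (WittVector.wittSub p j))) := by
  obtain ⟨f, hfx, hfy, hfz, hft⟩ := exists_shear_algHom (p := p) R m n hc 1
  obtain ⟨g, hgx, hgy, hgz, hgt⟩ := exists_shear_algHom (p := p) R m n hc (-1)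
  refine ⟨.ofAlgHom f g
    (shear_comp_shear R hc rfl hfx hfy hfz hft hgx hgy hgz hgt)
    (shear_comp_shear R hc (neg_neg 1) hgx hgy hgz hgt hfx hfy hfz hft),
    fun i => (hfx i).trans ?_, hfy, hfz, fun j => (hft j).trans ?_⟩
  · have : (MvPolynomial.X 0 + MvPolynomial.C 1 * MvPolynomial.X 1 : MvPolynomial (Fin 2) ℤ) =
        MvPolynomial.X 0 + MvPolynomial.X 1 := by simp
    rw [wittComb, this]
    rfl
  · have : (MvPolynomial.X 0 + MvPolynomial.C (-1) * MvPolynomial.X 1 : MvPolynomial (Fin 2) ℤ) =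
        MvPolynomial.X 0 - MvPolynomial.X 1 := by simp [sub_eq_add_neg]
    rw [wittComb, this]
    rfl

end
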